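/- arXiv:1612.03455 — 2 statements merged into one kernel-verified Lean document; each statement's English description precedes it below -/
import Mathlib

section
/- Let D be an m×m real diagonal positive definite matrix, let P be an m×m real symmetric positive definite matrix whose diagonal part satisfies P_diag ⪯ D, and let K̂ be an m×m real diagonal positive semidefinite matrix. Then the diagonal part of (P⁻¹ + K̂)⁻¹ satisfies ((P⁻¹ + K̂)⁻¹)_diag ⪯ (D⁻¹ + K̂)⁻¹. -/
open Matrix

/-- The variational lower bound `xᵢ² / Pᵢᵢ ≤ xᵀ P⁻¹ x`. -/
theorem Matrix.PosDef.sq_div_diag_le_dotProduct_inv_mulVec {n : Type*} [Fintype n] [DecidableEq n]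
    {P : Matrix n n ℝ} (hP : P.PosDef) (x : n → ℝ) (i : n) :
    x i ^ 2 / P i i ≤ x ⬝ᵥ (P⁻¹ *ᵥ x) := by
  have hp : 0 < P i i := hP.diag_pos
  have hPy : P *ᵥ (P⁻¹ *ᵥ x) = x := by
    rw [mulVec_mulVec, mul_nonsing_inv P ((isUnit_iff_isUnit_det P).1 hP.isUnit), one_mulVec]
  set y := P⁻¹ *ᵥ x
  set t := x i / P i i with ht
  have hsymm : y ⬝ᵥ (P *ᵥ Pi.single i t) = t * x i := by
    have hT : Pᵀ = P := by simpa [IsHermitian, conjTranspose] using hP.isHermitian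
    rw [dotProduct_mulVec, ← mulVec_transpose, hT, hPy, dotProduct_single, mul_comm]
  have h := hP.posSemidef.dotProduct_mulVec_nonneg (y - Pi.single i t)
  have hs : Pi.single i t ⬝ᵥ (P *ᵥ Pi.single i t) = t * (P i i * t) := by
    simp [single_dotProduct, mulVec_single, mul_comm]
  rw [star_trivial, mulVec_sub, hPy, sub_dotProduct, dotProduct_sub, dotProduct_sub, hsymm, hs,
    single_dotProduct, dotProduct_comm y x] at h
  have e : P i i * t = x i := by rw [ht]; field_simp
  have e' : x i ^ 2 / P i i = t * x i := by rw [ht]; ring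
  rw [e] at h
  linarith

/-- Adding a nonnegative diagonal matrix to the inverse of `P` shrinks each diagonal entry at least
as much as in the scalar case. -/
theorem Matrix.PosDef.inv_add_diagonal_inv_diag_le {n : Type*} [Fintype n] [DecidableEq n]
    {P : Matrix n n ℝ} (hP : P.PosDef) {k : n → ℝ} (hk : ∀ j, 0 ≤ k j) (i : n) :
    (P⁻¹ + diagonal k)⁻¹ i i ≤ ((P i i)⁻¹ + k i)⁻¹ := by
  have hp : 0 < P i i := hP.diag_pos
  have hM : (P⁻¹ + diagonal k).PosDef := hP.inv.add_posSemidef (PosSemidef.diagonal hk)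
  have hq : 0 < (P⁻¹ + diagonal k)⁻¹ i i := hM.inv.diag_pos
  set M := P⁻¹ + diagonal k with hMdef
  set x : n → ℝ := M⁻¹ *ᵥ Pi.single i 1 with hx
  have hxi : x i = M⁻¹ i i := by simp [hx]
  have hMx : M *ᵥ x = Pi.single i 1 := by
    rw [hx, mulVec_mulVec, mul_nonsing_inv M ((isUnit_iff_isUnit_det M).1 hM.isUnit), one_mulVec]
  have hquad : x ⬝ᵥ (P⁻¹ *ᵥ x) + x ⬝ᵥ (diagonal k *ᵥ x) = x i := by
    rw [← dotProduct_add, ← add_mulVec, ← hMdef, hMx, dotProduct_single, mul_one]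
  have hdiag : k i * x i ^ 2 ≤ x ⬝ᵥ (diagonal k *ᵥ x) := by
    have h := Finset.single_le_sum (f := fun j => x j * (k j * x j))
      (fun j _ => by nlinarith [mul_nonneg (hk j) (sq_nonneg (x j))]) (Finset.mem_univ i)
    simp only [dotProduct, mulVec_diagonal]
    linarith
  have hinv := hP.sq_div_diag_le_dotProduct_inv_mulVec x i
  rw [← hxi] at hq ⊢
  have hs : 0 < (P i i)⁻¹ + k i := add_pos_of_pos_of_nonneg (inv_pos.2 hp) (hk i)
  rw [← one_div, le_div_iff₀ hs]
  rw [div_eq_mul_inv] at hinv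
  refine le_of_mul_le_mul_left ?_ hq
  linarith

/-- If `D` is diagonal positive definite, `P` is symmetric positive definite
with diagonal part `P_diag ⪯ D`, and `K̂` is diagonal PSD, then
`((P⁻¹ + K̂)⁻¹)_diag ⪯ (D⁻¹ + K̂)⁻¹` in the Loewner order. -/
theorem diag_inv_add_le_of_diag_le (m : ℕ)
    (D P Khat : Matrix (Fin m) (Fin m) ℝ)
    (hD_diag : D.IsDiag) (hD : D.PosDef)
    (hP : P.PosDef)
    (hPdiag_le : (D - Matrix.diagonal fun i => P i i).PosSemidef)
    (hKhat_diag : Khat.IsDiag) (hKhat : Khat.PosSemidef) :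
    ((D⁻¹ + Khat)⁻¹
      - Matrix.diagonal fun i => (P⁻¹ + Khat)⁻¹ i i).PosSemidef := by
  obtain ⟨d, rfl⟩ : ∃ d, diagonal d = D := ⟨_, hD_diag.diagonal_diag⟩
  obtain ⟨k, rfl⟩ : ∃ k, diagonal k = Khat := ⟨_, hKhat_diag.diagonal_diag⟩
  have hd : ∀ i, 0 < d i := posDef_diagonal_iff.1 hD
  have hk : ∀ i, 0 ≤ k i := posSemidef_diagonal_iff.1 hKhat
  have hle : ∀ i, P i i ≤ d i := by
    rw [diagonal_sub, posSemidef_diagonal_iff] at hPdiag_le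
    exact fun i => sub_nonneg.1 (hPdiag_le i)
  have hs : ∀ i, 0 < (d i)⁻¹ + k i := fun i => add_pos_of_pos_of_nonneg (inv_pos.2 (hd i)) (hk i)
  have hinv : ((diagonal d)⁻¹ + diagonal k)⁻¹ = diagonal fun i => ((d i)⁻¹ + k i)⁻¹ := by
    have hdinv : (diagonal d)⁻¹ = diagonal fun i => (d i)⁻¹ :=
      inv_eq_right_inv (by simp [diagonal_mul_diagonal, (hd _).ne'])
    rw [hdinv, diagonal_add]
    exact inv_eq_right_inv (by simp [diagonal_mul_diagonal, (hs _).ne'])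
  rw [hinv, diagonal_sub, posSemidef_diagonal_iff]
  intro i
  have hp : 0 < P i i := hP.diag_pos
  refine sub_nonneg.2 ((hP.inv_add_diagonal_inv_diag_le hk i).trans ?_)
  exact inv_anti₀ (hs i) (add_le_add_left (inv_anti₀ hp (hle i)) _)
end

section
/- Let k = l₁ + l₂ and let K be the k×k block-diagonal matrix diag(A, B) with A an l₁×l₁ diagonal positive semidefinite matrix and B an l₂×l₂ diagonal negative definite matrix. Let d₁, d₂ be positive reals with d₂ ≤ d₁ such that d₁⁻¹·I + K is positive definite, set D̂₁ := (d₁⁻¹·I + K)⁻¹, and let G be the k×k block-diagonal matrix whose upper-left l₁×l₁ block is (D̂₁)_{l₁} and whose lower-right l₂×l₂ block is d₂·I. Then G is positive definite and G⁻¹ ⪰ D̂₁⁻¹. -/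
open Matrix

/-- The inverse of a diagonal matrix with nonzero real entries is taken entrywise. -/
theorem inv_diagonal_of_ne_zero {n : Type*} [Fintype n] [DecidableEq n] (v : n → ℝ)
    (hv : ∀ i, v i ≠ 0) : (diagonal v)⁻¹ = diagonal fun i => (v i)⁻¹ := by
  refine inv_eq_right_inv ?_
  rw [diagonal_mul_diagonal, ← diagonal_one]
  congr 1
  ext i
  exact mul_inv_cancel₀ (hv i)

/-- Case `d₂ ≤ d₁`: with `K = diag(A, B)` (`A` diagonal PSD, `B` diagonal
negative definite) and `d₁⁻¹·I + K` positive definite, setting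
`D̂₁ = (d₁⁻¹·I + K)⁻¹` and `G = diag((D̂₁)_{l₁}, d₂·I)`, the matrix `G` is
positive definite and `G⁻¹ ⪰ D̂₁⁻¹`. -/
theorem Ginv_ge_Dhatinv (l₁ l₂ : ℕ)
    (A : Matrix (Fin l₁) (Fin l₁) ℝ) (hA_diag : A.IsDiag) (hA : A.PosSemidef)
    (B : Matrix (Fin l₂) (Fin l₂) ℝ) (hB_diag : B.IsDiag) (hB : (-B).PosDef)
    (K : Matrix (Fin l₁ ⊕ Fin l₂) (Fin l₁ ⊕ Fin l₂) ℝ)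
    (hK_def : K = Matrix.fromBlocks A 0 0 B)
    (d₁ d₂ : ℝ) (hd₁ : 0 < d₁) (hd₂ : 0 < d₂) (hdd : d₂ ≤ d₁)
    (hpd : (d₁⁻¹ • (1 : Matrix (Fin l₁ ⊕ Fin l₂) (Fin l₁ ⊕ Fin l₂) ℝ) + K).PosDef)
    (Dhat : Matrix (Fin l₁ ⊕ Fin l₂) (Fin l₁ ⊕ Fin l₂) ℝ)
    (hDhat : Dhat = (d₁⁻¹ • 1 + K)⁻¹)
    (G : Matrix (Fin l₁ ⊕ Fin l₂) (Fin l₁ ⊕ Fin l₂) ℝ)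
    (hG : G = Matrix.fromBlocks (Matrix.toBlocks₁₁ Dhat) 0 0 (d₂ • 1)) :
    G.PosDef ∧ (G⁻¹ - Dhat⁻¹).PosSemidef := by
  obtain ⟨a, rfl⟩ : ∃ a, A = diagonal a := ⟨A.diag, hA_diag.diagonal_diag.symm⟩
  obtain ⟨b, rfl⟩ : ∃ b, B = diagonal b := ⟨B.diag, hB_diag.diagonal_diag.symm⟩
  have hb : ∀ j, b j < 0 := by
    rw [diagonal_neg, posDef_diagonal_iff] at hB
    exact fun j => neg_pos.mp (hB j)
  let v : Fin l₁ ⊕ Fin l₂ → ℝ := fun i => d₁⁻¹ + Sum.elim a b i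
  have hM : d₁⁻¹ • (1 : Matrix (Fin l₁ ⊕ Fin l₂) (Fin l₁ ⊕ Fin l₂) ℝ) + K = diagonal v := by
    rw [hK_def, fromBlocks_diagonal, smul_one_eq_diagonal, diagonal_add]
  rw [hM] at hpd hDhat
  have hv : ∀ i, 0 < v i := posDef_diagonal_iff.mp hpd
  have hD : Dhat = diagonal fun i => (v i)⁻¹ := by
    rw [hDhat, inv_diagonal_of_ne_zero v fun i => (hv i).ne']
  let g : Fin l₁ ⊕ Fin l₂ → ℝ := Sum.elim (fun i => (v (Sum.inl i))⁻¹) fun _ => d₂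
  have hGg : G = diagonal g := by
    have hD₁₁ : Dhat.toBlocks₁₁ = diagonal fun i => (v (Sum.inl i))⁻¹ := by
      rw [hD]
      exact toBlocks₁₁_diagonal _
    rw [hG, hD₁₁, smul_one_eq_diagonal, fromBlocks_diagonal]
  have hg : ∀ i, 0 < g i := by
    rintro (i | j)
    · exact inv_pos.mpr (hv _)
    · exact hd₂
  refine ⟨hGg ▸ posDef_diagonal_iff.mpr hg, ?_⟩
  rw [hGg, hD, inv_diagonal_of_ne_zero g fun i => (hg i).ne',
    inv_diagonal_of_ne_zero _ fun i => (inv_pos.mpr (hv i)).ne', diagonal_sub,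
    posSemidef_diagonal_iff]
  rintro (i | j)
  · simp [g]
  · have hle : d₁⁻¹ ≤ d₂⁻¹ := inv_anti₀ hd₂ hdd
    simp only [g, v, Sum.elim_inr, inv_inv]
    linarith [hb j]
end
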